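/- arXiv:2102.10723 — 3 statements merged into one kernel-verified Lean document; each statement's English description precedes it below -/
import Mathlib

section
/- Let D > 1 be a square-free integer with D ≡ 1 (mod 8), F = ℚ(√D), 𝒪 the ring of integers of F, and 𝔡 the different ideal of F/ℚ. Then there exist a totally positive β ∈ F^×, two distinct prime ideals 𝔭 ≠ 𝔭' of 𝒪 each of absolute norm 3, and a fractional ideal 𝔞 of F with (8β)·𝔡·𝔭·𝔭' = 𝔞² if and only if D ≡ 1 (mod 24) and every prime p dividing D satisfies p ≡ 1 (mod 4). -/
open scoped NumberField nonZeroDivisors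

lemma Int.sq_ne_ratCast_of_squarefree {D : ℤ} (hD1 : 1 < D) (hsq : Squarefree D) (r : ℚ) :
    r ^ 2 ≠ (D : ℚ) := by
  intro h
  obtain ⟨n, rfl⟩ : ∃ n : ℤ, (n : ℚ) = r := by
    refine (IsIntegrallyClosed.isIntegral_iff (R := ℤ)).mp (IsIntegral.of_pow two_pos ?_)
    exact h ▸ isIntegral_algebraMap (x := D)
  have hn : n ^ 2 = D := by exact_mod_cast h
  have hu := hsq n ⟨1, by rw [← hn]; ring⟩
  rw [Int.isUnit_iff] at hu
  rcases hu with rfl | rfl <;> norm_num at hn <;> omega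

/-- A rational `w` with `D * w ^ 2` integral and `D` squarefree is an integer. -/
lemma Rat.exists_int_of_squarefree_mul_sq {D m : ℤ} (hsq : Squarefree D) {w : ℚ}
    (h : (D : ℚ) * w ^ 2 = m) : ∃ t : ℤ, w = t := by
  have hden : (w.den : ℚ) ≠ 0 := by exact_mod_cast w.den_nz
  have h1 : D * w.num ^ 2 = m * (w.den : ℤ) ^ 2 := by
    rw [← Rat.num_div_den w] at h
    field_simp at h
    rw [mul_comm m]
    exact_mod_cast h
  have hc : IsCoprime ((w.den : ℤ) ^ 2) (w.num ^ 2) :=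
    (Rat.isCoprime_num_den w).symm.pow
  have hdvd : (w.den : ℤ) * w.den ∣ D := by
    rw [← sq]
    exact hc.dvd_of_dvd_mul_right ⟨m, by rw [h1]; ring⟩
  have hu := Int.isUnit_iff.mp (hsq _ hdvd)
  refine ⟨w.num, ?_⟩
  have : w.den = 1 := by omega
  conv_lhs => rw [← Rat.num_div_den w, this]
  simp

lemma Nat.mod_four_ne_three_of_mul_sq_eq_sq_add_sq {n p X a b : ℕ} (hn : Squarefree n)
    (hp : p.Prime) (hpn : p ∣ n) (hX : X ≠ 0) (h : n * X ^ 2 = a ^ 2 + b ^ 2) : p % 4 ≠ 3 := by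
  intro h3
  have : Fact p.Prime := ⟨hp⟩
  have hn0 : n ≠ 0 := hn.ne_zero
  have he := Nat.eq_sq_add_sq_iff.mp ⟨a, b, h⟩ p
    (Nat.mem_primeFactors.mpr ⟨hp, hpn.mul_right _, by positivity⟩) h3
  have h1 : padicValNat p n = 1 := by
    have := hn.natFactorization_le_one p
    rw [Nat.factorization_def _ hp] at this
    have := one_le_padicValNat_of_dvd hn0 hpn
    omega
  rw [padicValNat.mul hn0 (by positivity), padicValNat.pow, h1] at he
  grind

lemma Rat.mod_four_ne_three_of_mul_sq_eq_sq_add_sq {D : ℤ} (hD : 0 < D) (hsq : Squarefree D)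
    {x r s : ℚ} (hx : x ≠ 0) (h : (D : ℚ) * x ^ 2 = r ^ 2 + s ^ 2) {p : ℕ} (hp : p.Prime)
    (hpD : (p : ℤ) ∣ D) : p % 4 ≠ 3 := by
  refine Nat.mod_four_ne_three_of_mul_sq_eq_sq_add_sq (n := D.natAbs)
    (X := (x.num * r.den * s.den).natAbs) (a := (r.num * x.den * s.den).natAbs)
    (b := (s.num * r.den * x.den).natAbs) (Int.squarefree_natAbs.mpr hsq) hp
    (Int.natCast_dvd.mp hpD) ?_ ?_
  · simp [hx]
  · zify
    simp only [sq_abs, abs_of_pos hD]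
    have h1 : (x.den : ℚ) ≠ 0 := by exact_mod_cast x.den_nz
    have h2 : (r.den : ℚ) ≠ 0 := by exact_mod_cast r.den_nz
    have h3 : (s.den : ℚ) ≠ 0 := by exact_mod_cast s.den_nz
    rw [← Rat.num_div_den x, ← Rat.num_div_den r, ← Rat.num_div_den s] at h
    field_simp at h
    have h' : (D : ℚ) * (x.num * r.den * s.den) ^ 2
        = (r.num * x.den * s.den) ^ 2 + (s.num * r.den * x.den) ^ 2 := by linear_combination h
    exact_mod_cast h'

/-- A squarefree `D ≡ 1 (mod 8)` without prime factors `≢ 1 (mod 4)` is `a ^ 2 + (2 * c) ^ 2`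
with `a` and `c` coprime. -/
lemma Int.exists_eq_sq_add_four_mul_sq {D : ℤ} (hD1 : 1 < D) (hsq : Squarefree D)
    (hD8 : D % 8 = 1) (hp : ∀ p : ℕ, p.Prime → (p : ℤ) ∣ D → p % 4 = 1) :
    ∃ a c : ℤ, D = a ^ 2 + 4 * c ^ 2 ∧ IsCoprime a c ∧ c ≠ 0 := by
  suffices h : ∃ a c : ℤ, D = a ^ 2 + 4 * c ^ 2 by
    obtain ⟨a, c, h⟩ := h
    refine ⟨a, c, h, ?_, ?_⟩
    · rw [Int.isCoprime_iff_gcd_eq_one]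
      obtain ⟨u, hu⟩ := Int.gcd_dvd_left a c
      obtain ⟨v, hv⟩ := Int.gcd_dvd_right a c
      have := Int.isUnit_iff.mp (hsq (Int.gcd a c : ℤ) ⟨u ^ 2 + 4 * v ^ 2, by
        rw [h]; nth_rw 1 [hu]; nth_rw 2 [hv]; ring⟩)
      omega
    · rintro rfl
      exact Int.sq_ne_ratCast_of_squarefree hD1 hsq a (by rw [h]; push_cast; ring)
  lift D to ℕ using by omega
  obtain ⟨x, y, hxy⟩ := (Nat.eq_sq_add_sq_iff (n := D)).mpr fun q hq h3 ↦ by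
    have := hp q (Nat.prime_of_mem_primeFactors hq)
      (Int.natCast_dvd_natCast.mpr (Nat.dvd_of_mem_primeFactors hq))
    omega
  rcases Nat.even_or_odd' x with ⟨k, rfl | rfl⟩
  · exact ⟨y, k, by rw [hxy]; push_cast; ring⟩
  · rcases Nat.even_or_odd' y with ⟨l, rfl | rfl⟩
    · exact ⟨2 * k + 1, l, by rw [hxy]; push_cast; ring⟩
    · exfalso
      have : D = 2 * (2 * k ^ 2 + 2 * k + 2 * l ^ 2 + 2 * l + 1) := by rw [hxy]; ring
      omega

section
open QuadraticAlgebra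
variable {F : Type*} [Field F] [NumberField F] {D : ℤ} {sd : F}

/-- A field generated over `ℚ` by a square root of the nonsquare `D` is the quadratic algebra
`ℚ[ω]` with `ω ^ 2 = D`. -/
lemma exists_quadraticAlgebra_algEquiv (hD : ∀ r : ℚ, r ^ 2 ≠ D) (hsd : sd ^ 2 = (D : F))
    (hadj : Algebra.adjoin ℚ {sd} = ⊤) :
    ∃ e : QuadraticAlgebra ℚ (D : ℚ) 0 ≃ₐ[ℚ] F, e ω = sd := by
  let f : QuadraticAlgebra ℚ (D : ℚ) 0 →ₐ[ℚ] F :=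
    lift ⟨sd, by rw [← sq, hsd]; simp [Algebra.smul_def]⟩
  have hf : f ω = sd := by
    change (0 : ℚ) • (1 : F) + (1 : ℚ) • sd = sd
    simp
  have : Fact (∀ r : ℚ, r ^ 2 ≠ D + 0 * r) := ⟨fun r ↦ by simpa using hD r⟩
  refine ⟨AlgEquiv.ofBijective f ⟨f.toRingHom.injective, ?_⟩, hf⟩
  rw [← AlgHom.range_eq_top, eq_top_iff, ← hadj, Algebra.adjoin_le_iff]
  rintro _ rfl
  exact ⟨ω, hf⟩

lemma quadraticAlgebra_algEquiv_apply (e : QuadraticAlgebra ℚ (D : ℚ) 0 ≃ₐ[ℚ] F)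
    (he : e ω = sd) (x y : ℚ) : e ⟨x, y⟩ = x + y * sd := by
  rw [mk_eq_add_smul_omega, map_add, AlgEquiv.commutes, map_smul, he, Algebra.smul_def]
  simp

lemma exists_eq_ratCast_add_mul (hD : ∀ r : ℚ, r ^ 2 ≠ D) (hsd : sd ^ 2 = (D : F))
    (hadj : Algebra.adjoin ℚ {sd} = ⊤) (z : F) : ∃ x y : ℚ, z = x + y * sd := by
  obtain ⟨e, he⟩ := exists_quadraticAlgebra_algEquiv hD hsd hadj
  obtain ⟨⟨x, y⟩, rfl⟩ := e.surjective z
  exact ⟨x, y, quadraticAlgebra_algEquiv_apply e he x y⟩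

lemma exists_ringHom_apply_eq (hD : ∀ r : ℚ, r ^ 2 ≠ D) (hsd : sd ^ 2 = (D : F))
    (hadj : Algebra.adjoin ℚ {sd} = ⊤) {A : Type*} [Field A] [CharZero A] {u : A}
    (hu : u ^ 2 = (D : A)) : ∃ φ : F →+* A, φ sd = u := by
  obtain ⟨e, he⟩ := exists_quadraticAlgebra_algEquiv hD hsd hadj
  let f : QuadraticAlgebra ℚ (D : ℚ) 0 →ₐ[ℚ] A :=
    lift ⟨u, by rw [← sq, hu]; simp [Algebra.smul_def]⟩
  refine ⟨f.toRingHom.comp e.symm.toRingEquiv.toRingHom, ?_⟩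
  have : e.symm sd = ω := by rw [← he, e.symm_apply_apply]
  change f (e.symm sd) = u
  rw [this]
  change (0 : ℚ) • (1 : A) + (1 : ℚ) • u = u
  simp

lemma norm_ratCast_add_mul (hD : ∀ r : ℚ, r ^ 2 ≠ D) (hsd : sd ^ 2 = (D : F))
    (hadj : Algebra.adjoin ℚ {sd} = ⊤) (x y : ℚ) :
    Algebra.norm ℚ ((x : F) + y * sd) = x ^ 2 - D * y ^ 2 := by
  obtain ⟨e, he⟩ := exists_quadraticAlgebra_algEquiv hD hsd hadj
  rw [← quadraticAlgebra_algEquiv_apply e he, Algebra.norm_eq_of_algEquiv, Algebra.norm_apply]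
  refine (det_toLinearMap_eq_norm _).trans ?_
  rw [norm_def]
  ring

end

section
variable {F : Type*} [Field F] [NumberField F] {D : ℤ} {sd : F}

lemma exists_int_coords_of_isIntegral (hD1 : 1 < D) (hsq : Squarefree D) (hD4 : D % 4 = 1)
    (hsd : sd ^ 2 = (D : F)) (hadj : Algebra.adjoin ℚ {sd} = ⊤) {z : F} (hz : IsIntegral ℤ z) :
    ∃ s t : ℤ, 2 * z = 2 * s + t * (1 + sd) := by
  have hD := Int.sq_ne_ratCast_of_squarefree hD1 hsq
  obtain ⟨x, y, rfl⟩ := exists_eq_ratCast_add_mul hD hsd hadj z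
  obtain ⟨σ, hσ⟩ := exists_ringHom_apply_eq hD hsd hadj (u := -sd) (by rw [neg_sq, hsd])
  have hσz : σ (x + y * sd) = x - y * sd := by simp [hσ, sub_eq_add_neg]
  have hz' : IsIntegral ℤ ((x : F) - y * sd) := hσz ▸ hz.map σ.toIntAlgHom
  have key : ∀ w : ℚ, IsIntegral ℤ (w : F) → ∃ n : ℤ, w = n := fun w hw ↦ by
    obtain ⟨n, hn⟩ := (IsIntegrallyClosed.isIntegral_iff (R := ℤ) (K := ℚ)).mp
      ((isIntegral_algHom_iff ((Rat.castHom F).toIntAlgHom) (Rat.castHom F).injective).mp hw)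
    exact ⟨n, hn.symm⟩
  obtain ⟨s, hs⟩ := key (2 * x) (by
    rw [show ((2 * x : ℚ) : F) = (x + y * sd) + (x - y * sd) by push_cast; ring]
    exact hz.add hz')
  obtain ⟨n, hn⟩ := key (x ^ 2 - D * y ^ 2) (by
    rw [show ((x ^ 2 - D * y ^ 2 : ℚ) : F) = (x + y * sd) * (x - y * sd) by
      push_cast; rw [← hsd]; ring]
    exact hz.mul hz')
  obtain ⟨t, ht⟩ := Rat.exists_int_of_squarefree_mul_sq (m := s ^ 2 - 4 * n) hsq (w := 2 * y) (by
    push_cast; rw [← hs, ← hn]; ring)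
  have hst : s ^ 2 - D * t ^ 2 = 4 * n := by
    have : (s : ℚ) ^ 2 - D * t ^ 2 = 4 * n := by rw [← hs, ← hn, ← ht]; ring
    exact_mod_cast this
  obtain ⟨k, hk⟩ : (2 : ℤ) ∣ s - t := by
    rw [← even_iff_two_dvd, Int.even_sub]
    have h : Even (s ^ 2 - D * t ^ 2) := ⟨2 * n, by rw [hst]; ring⟩
    have hDe : ¬ Even D := by rw [Int.even_iff]; omega
    simpa [Int.even_sub, Int.even_mul, Int.even_pow, hDe] using h
  refine ⟨k, t, ?_⟩
  have hs' : (2 : F) * x = s := by exact_mod_cast congrArg (Rat.cast : ℚ → F) hs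
  have ht' : (2 : F) * y = t := by exact_mod_cast congrArg (Rat.cast : ℚ → F) ht
  have hk' : (s : F) - t = 2 * k := by exact_mod_cast congrArg (Int.cast : ℤ → F) hk
  linear_combination hs' + sd * ht' + hk'

open Polynomial in
lemma differentIdeal_eq_span_of_sq_eq (hD1 : 1 < D) (hsq : Squarefree D) (hD4 : D % 4 = 1)
    {δ : 𝓞 F} (hδ : δ ^ 2 = (D : 𝓞 F)) (hadj : Algebra.adjoin ℚ {algebraMap (𝓞 F) F δ} = ⊤) :
    differentIdeal ℤ (𝓞 F) = Ideal.span {δ} := by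
  have hδF : algebraMap (𝓞 F) F δ ^ 2 = (D : F) := by
    simpa using congrArg (algebraMap (𝓞 F) F) hδ
  obtain ⟨m, hm⟩ : ∃ m : ℤ, D = 1 + 4 * m := ⟨D / 4, by omega⟩
  have hmF : (D : F) = 1 + 4 * m := by exact_mod_cast congrArg (Int.cast : ℤ → F) hm
  obtain ⟨P, hP⟩ : ∃ P : ℤ[X], P = X ^ 2 - X - C m := ⟨_, rfl⟩
  have hPdeg : P.natDegree = 2 := by rw [hP]; compute_degree!
  have hPm : P.Monic := by rw [hP]; monicity!
  have hroot : ((1 + algebraMap (𝓞 F) F δ) / 2) ^ 2 - (1 + algebraMap (𝓞 F) F δ) / 2 - m = 0 := by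
    linear_combination (1 / 4) * hδF + (1 / 4) * hmF
  obtain ⟨θ, hθF⟩ : ∃ θ : 𝓞 F, algebraMap (𝓞 F) F θ = (1 + algebraMap (𝓞 F) F δ) / 2 :=
    ⟨⟨(1 + algebraMap (𝓞 F) F δ) / 2, P, hPm, by
      rw [← aeval_def, hP]
      simpa using hroot⟩, rfl⟩
  have hθ : 2 * θ = 1 + δ := by
    apply FaithfulSMul.algebraMap_injective (𝓞 F) F
    rw [map_mul, map_add, hθF, map_ofNat, map_one]
    ring
  have hPθ : aeval θ P = 0 := by
    apply FaithfulSMul.algebraMap_injective (𝓞 F) F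
    simpa [hP, hθF] using hroot
  have htop : Algebra.adjoin ℤ {θ} = ⊤ := by
    rw [eq_top_iff]
    rintro z -
    obtain ⟨s, t, hst⟩ := exists_int_coords_of_isIntegral hD1 hsq hD4 hδF hadj z.isIntegral_coe
    have hz : z = s + t * θ := by
      apply FaithfulSMul.algebraMap_injective (𝓞 F) F
      rw [map_add, map_mul, hθF, map_intCast, map_intCast]
      linear_combination hst / 2
    rw [hz]
    exact add_mem (intCast_mem _ _) (mul_mem (intCast_mem _ _) (Algebra.self_mem_adjoin_singleton ℤ θ))
  have hmin : minpoly ℤ θ = P := by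
    have hint := NumberField.RingOfIntegers.isIntegral θ
    refine (eq_of_monic_of_dvd_of_natDegree_le (minpoly.monic hint) hPm
      (minpoly.isIntegrallyClosed_dvd hint hPθ) ?_).symm
    rw [hPdeg, minpoly.two_le_natDegree_iff hint]
    rintro ⟨n, hn⟩
    refine Int.sq_ne_ratCast_of_squarefree hD1 hsq (2 * n - 1) ?_
    have h : algebraMap (𝓞 F) F δ = 2 * n - 1 := by
      have := congrArg (algebraMap (𝓞 F) F) hn
      simp only [eq_intCast, map_intCast] at this
      rw [hθF] at this
      linear_combination (-2) * this
    have h2 : ((2 * n - 1 : ℤ) : F) ^ 2 = D := by push_cast; rw [← h, hδF]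
    exact_mod_cast h2
  have hadj' : Algebra.adjoin ℚ {algebraMap (𝓞 F) F θ} = ⊤ := by
    rw [eq_top_iff, ← hadj, Algebra.adjoin_le_iff]
    rintro _ rfl
    have : algebraMap (𝓞 F) F δ = algebraMap (𝓞 F) F θ + algebraMap (𝓞 F) F θ - 1 := by rw [hθF]; ring
    rw [this]
    have h := Algebra.self_mem_adjoin_singleton ℚ (algebraMap (𝓞 F) F θ)
    exact sub_mem (add_mem h h) (one_mem _)
  have h := conductor_mul_differentIdeal ℤ ℚ F θ hadj'
  rw [conductor_eq_top_of_adjoin_eq_top htop, ← Ideal.one_eq_top, one_mul, hmin] at h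
  rw [h, hP]
  congr 2
  simp only [derivative_sub, derivative_X_pow, derivative_X, derivative_C]
  simp only [map_sub, map_mul, map_pow, aeval_X, aeval_C, map_one]
  simp
  linear_combination hθ

lemma Ideal.span_pair_sq_eq_of_mul_eq {R : Type*} [CommRing R] {x y a c : R} (h : x * y = -c ^ 2)
    (ha : x + y = a) (hac : IsCoprime a c) : Ideal.span {x, c} ^ 2 = Ideal.span {x} := by
  obtain ⟨u, v, huv⟩ := hac
  rw [sq, Ideal.span_pair_mul_span_pair]
  apply le_antisymm
  · rw [Ideal.span_le]
    rintro z (rfl | rfl | rfl | rfl) <;> rw [SetLike.mem_coe, Ideal.mem_span_singleton]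
    · exact ⟨x, rfl⟩
    · exact ⟨c, rfl⟩
    · exact ⟨c, mul_comm _ _⟩
    · exact ⟨-y, by linear_combination h⟩
  · rw [Ideal.span_singleton_le_iff_mem]
    have : x = u * (x * x) - u * (c * c) + v * (x * c) := by
      subst ha
      linear_combination (-x) * huv + u * h
    have hm := add_mem (sub_mem (x := u * (x * x)) (y := u * (c * c)) ?_ ?_)
      (?_ : v * (x * c) ∈ Ideal.span {x * x, x * c, c * x, c * c})
    · rwa [← this] at hm
    all_goals
      exact Ideal.mul_mem_left _ _ (Ideal.subset_span (by simp))

end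

section
variable {F : Type*} [Field F] [NumberField F] {D : ℤ} {sd : F}

lemma absNorm_span_three (hD : ∀ r : ℚ, r ^ 2 ≠ D) (hsd : sd ^ 2 = (D : F))
    (hadj : Algebra.adjoin ℚ {sd} = ⊤) : Ideal.absNorm (Ideal.span {(3 : 𝓞 F)}) = 9 := by
  obtain ⟨e, -⟩ := exists_quadraticAlgebra_algEquiv hD hsd hadj
  have h := Ideal.absNorm_span_natCast (S := 𝓞 F) 3
  rw [NumberField.RingOfIntegers.rank, ← e.toLinearEquiv.finrank_eq,
    QuadraticAlgebra.finrank_eq_two] at h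
  simpa using h

lemma add_intCast_notMem_span_three (hD1 : 1 < D) (hsq : Squarefree D) (hD4 : D % 4 = 1)
    {δ : 𝓞 F} (hδ : δ ^ 2 = (D : 𝓞 F)) (hadj : Algebra.adjoin ℚ {algebraMap (𝓞 F) F δ} = ⊤)
    (u : ℤ) : δ + u ∉ Ideal.span {(3 : 𝓞 F)} := by
  have hδF : algebraMap (𝓞 F) F δ ^ 2 = (D : F) := by
    simpa using congrArg (algebraMap (𝓞 F) F) hδ
  rw [Ideal.mem_span_singleton]
  rintro ⟨z, hz⟩
  obtain ⟨s, t, hst⟩ := exists_int_coords_of_isIntegral hD1 hsq hD4 hδF hadj z.isIntegral_coe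
  have hzF : algebraMap (𝓞 F) F δ + u = 3 * algebraMap (𝓞 F) F z := by
    simpa [map_ofNat] using congrArg (algebraMap (𝓞 F) F) hz
  have h : algebraMap (𝓞 F) F δ * (2 - 3 * t : ℤ) = (6 * s + 3 * t - 2 * u : ℤ) := by
    push_cast
    linear_combination 2 * hzF + 3 * hst
  have ht : ((2 - 3 * t : ℤ) : ℚ) ≠ 0 := by
    rw [Int.cast_ne_zero]
    omega
  refine Int.sq_ne_ratCast_of_squarefree hD1 hsq
    (((6 * s + 3 * t - 2 * u : ℤ) : ℚ) / (2 - 3 * t : ℤ)) ?_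
  rw [div_pow, div_eq_iff (pow_ne_zero 2 ht)]
  have h2 : ((6 * s + 3 * t - 2 * u : ℤ) : F) ^ 2 = D * ((2 - 3 * t : ℤ) : F) ^ 2 := by
    rw [← h, mul_pow, hδF]
  exact_mod_cast h2

lemma exists_primes_of_absNorm_three (hD1 : 1 < D) (hsq : Squarefree D) (hD4 : D % 4 = 1)
    (hD3 : D % 3 = 1) {δ : 𝓞 F} (hδ : δ ^ 2 = (D : 𝓞 F))
    (hadj : Algebra.adjoin ℚ {algebraMap (𝓞 F) F δ} = ⊤) :
    ∃ P P' : Ideal (𝓞 F), P ≠ P' ∧ P.IsPrime ∧ Ideal.absNorm P = 3 ∧ P'.IsPrime ∧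
      Ideal.absNorm P' = 3 ∧ P * P' = Ideal.span {3} := by
  have hδF : algebraMap (𝓞 F) F δ ^ 2 = (D : F) := by
    simpa using congrArg (algebraMap (𝓞 F) F) hδ
  obtain ⟨m, hm⟩ : ∃ m : ℤ, D = 1 + 3 * m := ⟨D / 3, by omega⟩
  have hmO : (D : 𝓞 F) = 1 + 3 * m := by exact_mod_cast congrArg (Int.cast : ℤ → 𝓞 F) hm
  obtain ⟨P, hP⟩ : ∃ P : Ideal (𝓞 F), P = Ideal.span {3, δ - 1} := ⟨_, rfl⟩
  obtain ⟨P', hP'⟩ : ∃ P' : Ideal (𝓞 F), P' = Ideal.span {3, δ + 1} := ⟨_, rfl⟩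
  have hmul : P * P' = Ideal.span {3} := by
    rw [hP, hP', Ideal.span_pair_mul_span_pair]
    apply le_antisymm
    · rw [Ideal.span_le]
      rintro z (rfl | rfl | rfl | rfl) <;> rw [SetLike.mem_coe, Ideal.mem_span_singleton]
      · exact ⟨3, rfl⟩
      · exact ⟨δ + 1, rfl⟩
      · exact ⟨δ - 1, mul_comm _ _⟩
      · exact ⟨m, by linear_combination hδ + hmO⟩
    · rw [Ideal.span_singleton_le_iff_mem]
      have h := sub_mem (sub_mem (x := (3 : 𝓞 F) * 3) (y := 3 * (δ + 1)) ?_ ?_)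
        (neg_mem (?_ : (δ - 1) * 3 ∈
          Ideal.span {(3 : 𝓞 F) * 3, 3 * (δ + 1), (δ - 1) * 3, (δ - 1) * (δ + 1)}))
      · convert h using 1
        ring
      all_goals exact Ideal.subset_span (by simp)
  have hne : ∀ u : ℤ, Ideal.span {(3 : 𝓞 F)} ≠ Ideal.span {3, δ + u} := fun u h ↦
    add_intCast_notMem_span_three hD1 hsq hD4 hδ hadj u (h ▸ Ideal.subset_span (by simp))
  have h9 : Ideal.absNorm P * Ideal.absNorm P' = 9 := by
    rw [← map_mul, hmul, absNorm_span_three (Int.sq_ne_ratCast_of_squarefree hD1 hsq) hδF hadj]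
  have h1 : Ideal.absNorm P ≠ 1 := fun h ↦ by
    rw [Ideal.absNorm_eq_one_iff] at h
    rw [h, Ideal.top_mul, hP'] at hmul
    exact hne 1 (by simpa using hmul.symm)
  have h1' : Ideal.absNorm P' ≠ 1 := fun h ↦ by
    rw [Ideal.absNorm_eq_one_iff] at h
    rw [h, Ideal.mul_top, hP] at hmul
    exact hne (-1) (by simpa [sub_eq_add_neg] using hmul.symm)
  have h3 : Ideal.absNorm P = 3 := by
    have hdvd : Ideal.absNorm P ∣ 3 ^ 2 := ⟨_, h9.symm⟩
    obtain ⟨k, hk, hk'⟩ := (Nat.dvd_prime_pow Nat.prime_three).mp hdvd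
    interval_cases k <;> simp_all
  have h3' : Ideal.absNorm P' = 3 := by rw [h3] at h9; omega
  refine ⟨P, P', ?_, Ideal.isPrime_of_irreducible_absNorm (h3 ▸ Nat.prime_three), h3,
    Ideal.isPrime_of_irreducible_absNorm (h3' ▸ Nat.prime_three), h3', hmul⟩
  intro hPP
  apply h1
  rw [Ideal.absNorm_eq_one_iff, Ideal.eq_top_iff_one]
  have h := add_mem (sub_mem (x := (3 : 𝓞 F)) (y := δ + 1) ?_ ?_) (?_ : δ - 1 ∈ P)
  · convert h using 1
    ring
  · exact hP ▸ Ideal.subset_span (by simp)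
  · exact hPP ▸ hP' ▸ Ideal.subset_span (by simp)
  · exact hP ▸ Ideal.subset_span (by simp)

lemma sq_ne_neg_one_of_card_eq_three {K : Type*} [CommRing K] [IsDomain K] (h : Nat.card K = 3)
    (d : K) : d ^ 2 ≠ -1 := by
  classical
  intro hd
  have : Finite K := Nat.finite_of_card_ne_zero (by omega)
  let : Fintype K := Fintype.ofFinite K
  let : Field K := Fintype.fieldOfDomain K
  have h3 : (3 : K) = 0 := by
    have := card_nsmul_eq_zero' (x := (1 : K))
    rw [h] at this
    simpa using this
  have hd3 : d ^ 3 = d := by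
    have := FiniteField.pow_card d
    rwa [← Nat.card_eq_fintype_card, h] at this
  have h0 : d = 0 := by linear_combination d * h3 - d * hd + hd3
  simp [h0] at hd

lemma mod_three_ne_two_of_absNorm_eq_three {δ : 𝓞 F} (hδ : δ ^ 2 = (D : 𝓞 F))
    {P : Ideal (𝓞 F)} [P.IsPrime] (hP : Ideal.absNorm P = 3) : D % 3 ≠ 2 := by
  intro h
  have hcard : Nat.card (𝓞 F ⧸ P) = 3 := by
    rw [← hP, Ideal.absNorm_apply, Submodule.cardQuot_apply]
  obtain ⟨m, hm⟩ : ∃ m : ℤ, D = -1 + 3 * m := ⟨D / 3 + 1, by omega⟩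
  have h3 : Ideal.Quotient.mk P 3 = 0 := by
    rw [Ideal.Quotient.eq_zero_iff_mem]
    exact_mod_cast hP ▸ Ideal.absNorm_mem P
  refine sq_ne_neg_one_of_card_eq_three hcard (Ideal.Quotient.mk P δ) ?_
  rw [← map_pow, hδ, hm]
  push_cast
  rw [map_add, map_mul, h3, map_neg, map_one, zero_mul, add_zero]

end

/-- Let `D > 1` be square-free with `D ≡ 1 (mod 8)`, `F = ℚ(√D)`,
`𝒪` its ring of integers and `𝔡` the different of `F/ℚ`.  There exist a totally
positive `β ∈ F^×`, two distinct prime ideals `𝔭 ≠ 𝔭'` of `𝒪`, each of absolute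
norm `3`, and a fractional ideal `𝔞` with `(8β)·𝔡·𝔭·𝔭' = 𝔞²` if and only if
`D ≡ 1 (mod 24)` and every prime `p ∣ D` satisfies `p ≡ 1 (mod 4)`. -/
theorem stmt14 (D : ℤ) (hD1 : 1 < D) (hsq : Squarefree D) (hD8 : D % 8 = 1)
    (F : Type*) [Field F] [NumberField F]
    (sd : F) (hsd : sd ^ 2 = (D : F)) (hadj : Algebra.adjoin ℚ {sd} = ⊤) :
    (∃ β : F, β ≠ 0 ∧ (∀ φ : F →+* ℝ, 0 < φ β) ∧
      ∃ P P' : Ideal (𝓞 F), P ≠ P' ∧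
        P.IsPrime ∧ Ideal.absNorm P = 3 ∧ P'.IsPrime ∧ Ideal.absNorm P' = 3 ∧
        ∃ a : FractionalIdeal (𝓞 F)⁰ F, a ≠ 0 ∧
          FractionalIdeal.spanSingleton (𝓞 F)⁰ (8 * β)
              * (differentIdeal ℤ (𝓞 F) : FractionalIdeal (𝓞 F)⁰ F)
              * (P : FractionalIdeal (𝓞 F)⁰ F) * (P' : FractionalIdeal (𝓞 F)⁰ F)
            = a ^ 2)
    ↔ (D % 24 = 1 ∧ ∀ p : ℕ, p.Prime → (p : ℤ) ∣ D → p % 4 = 1) := by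
  have hD := Int.sq_ne_ratCast_of_squarefree hD1 hsq
  have hD4 : D % 4 = 1 := by omega
  have hDR : (0 : ℝ) < D := by exact_mod_cast (by omega : 0 < D)
  obtain ⟨δ, rfl⟩ : ∃ δ : 𝓞 F, algebraMap (𝓞 F) F δ = sd :=
    ⟨⟨sd, IsIntegral.of_pow two_pos (by rw [hsd]; exact isIntegral_algebraMap (x := D))⟩, rfl⟩
  have hδ : δ ^ 2 = (D : 𝓞 F) := by
    apply FaithfulSMul.algebraMap_injective (𝓞 F) F
    simpa using hsd
  have hδ0 : algebraMap (𝓞 F) F δ ≠ 0 := by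
    rintro h
    rw [h] at hsd
    have : (0 : ℤ) = D := by exact_mod_cast (by simpa using hsd : (0 : F) = D)
    omega
  rw [differentIdeal_eq_span_of_sq_eq hD1 hsq hD4 hδ hadj, FractionalIdeal.coeIdeal_span_singleton]
  constructor
  · rintro ⟨β, hβ0, hβ, P, P', -, hPp, hP, -, hP', a, -, ha⟩
    suffices h : ∀ p : ℕ, p.Prime → (p : ℤ) ∣ D → p % 4 = 1 by
      refine ⟨?_, h⟩
      have h2 := mod_three_ne_two_of_absNorm_eq_three hδ hP
      have h0 : D % 3 ≠ 0 := fun h0 ↦ by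
        have := h 3 Nat.prime_three (Int.dvd_of_emod_eq_zero h0)
        omega
      omega
    intro p hp hpD
    have hodd : p % 4 ≠ 3 → p % 4 = 1 := by
      have : p % 2 = 1 := by
        rcases hp.eq_two_or_odd with rfl | h
        · omega
        · exact h
      omega
    apply hodd
    obtain ⟨x, y, rfl⟩ := exists_eq_ratCast_add_mul hD hsd hadj β
    have hpos : 0 < x ^ 2 - D * y ^ 2 := by
      obtain ⟨φ, hφ⟩ := exists_ringHom_apply_eq hD hsd hadj (Real.sq_sqrt hDR.le)
      obtain ⟨ψ, hψ⟩ := exists_ringHom_apply_eq hD hsd hadj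
        ((neg_sq (√(D : ℝ))).trans (Real.sq_sqrt hDR.le))
      have h := mul_pos (hβ φ) (hβ ψ)
      simp only [map_add, map_mul, map_ratCast, hφ, hψ] at h
      have h' : (0 : ℝ) < x ^ 2 - D * y ^ 2 := by
        rw [← Real.sq_sqrt hDR.le]
        linarith
      exact_mod_cast h'
    have hnorm := congrArg FractionalIdeal.absNorm ha
    have h8 : 8 * ((x : F) + y * algebraMap (𝓞 F) F δ)
        = ((8 * x : ℚ) : F) + (8 * y : ℚ) * algebraMap (𝓞 F) F δ := by push_cast; ring
    have hδN : algebraMap (𝓞 F) F δ = ((0 : ℚ) : F) + (1 : ℚ) * algebraMap (𝓞 F) F δ := by simp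
    rw [map_mul, map_mul, map_mul, map_pow, FractionalIdeal.absNorm_span_singleton,
      FractionalIdeal.absNorm_span_singleton, FractionalIdeal.coeIdeal_absNorm,
      FractionalIdeal.coeIdeal_absNorm, hP, hP', h8, norm_ratCast_add_mul hD hsd hadj, hδN,
      norm_ratCast_add_mul hD hsd hadj, ← abs_mul] at hnorm
    obtain ⟨q, hq⟩ : ∃ q, q = FractionalIdeal.absNorm a := ⟨_, rfl⟩
    have hDQ : (0 : ℚ) < D := by exact_mod_cast (by omega : 0 < D)
    have hmain : (D : ℚ) * x ^ 2 = (q / 24) ^ 2 + (D * y) ^ 2 := by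
      rw [← hq, abs_of_nonpos (by nlinarith [mul_pos hpos hDQ])] at hnorm
      push_cast at hnorm
      linear_combination hnorm / 576
    refine Rat.mod_four_ne_three_of_mul_sq_eq_sq_add_sq (by omega) hsq ?_ hmain hp hpD
    rintro rfl
    nlinarith [mul_nonneg hDQ.le (sq_nonneg y)]
  · rintro ⟨hD24, hp⟩
    obtain ⟨a, c, hac, hcop, hc0⟩ := Int.exists_eq_sq_add_four_mul_sq hD1 hsq hD8 hp
    obtain ⟨P, P', hPP, hPp, hP, hPp', hP', hmul⟩ :=
      exists_primes_of_absNorm_three hD1 hsq hD4 (by omega) hδ hadj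
    have hacF : (D : F) = a ^ 2 + 4 * c ^ 2 := by exact_mod_cast congrArg (Int.cast : ℤ → F) hac
    have hacR : (D : ℝ) = a ^ 2 + 4 * c ^ 2 := by exact_mod_cast congrArg (Int.cast : ℤ → ℝ) hac
    have hcR : (0 : ℝ) < c ^ 2 := by positivity
    set d := algebraMap (𝓞 F) F δ
    have hint : IsIntegral ℤ ((a + d) / 2) := by
      refine ⟨Polynomial.X ^ 2 - Polynomial.C a * Polynomial.X - Polynomial.C (c ^ 2),
        by monicity!, ?_⟩
      rw [← Polynomial.aeval_def]
      simp
      linear_combination (1 / 4) * hsd + (1 / 4) * hacF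
    obtain ⟨γ, hγ⟩ : ∃ γ : 𝓞 F, algebraMap (𝓞 F) F γ = (a + d) / 2 := ⟨⟨_, hint⟩, rfl⟩
    have hγ2 : γ * (a - γ) = -(c : 𝓞 F) ^ 2 := by
      apply FaithfulSMul.algebraMap_injective (𝓞 F) F
      simp [hγ]
      linear_combination (-1 / 4) * hsd - (1 / 4) * hacF
    have hsqI := Ideal.span_pair_sq_eq_of_mul_eq hγ2 (add_sub_cancel _ _)
      (by simpa using hcop.map (Int.castRingHom (𝓞 F)))
    have hpos : ∀ φ : F →+* ℝ, 0 < φ (6 * algebraMap (𝓞 F) F γ / d) := fun φ ↦ by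
      have hφ : φ d ^ 2 = a ^ 2 + 4 * c ^ 2 := by rw [← map_pow, hsd, map_intCast, hacR]
      have hφ0 : φ d ≠ 0 := by simpa using hδ0
      have h : φ (6 * algebraMap (𝓞 F) F γ / d) = 3 * (φ d * (a + φ d)) / φ d ^ 2 := by
        rw [hγ]
        simp only [map_div₀, map_mul, map_add, map_intCast, map_ofNat]
        field_simp
        ring
      rw [h]
      have : 0 < φ d * (a + φ d) := by nlinarith [sq_nonneg (φ d + a)]
      positivity
    have hβ0 : 6 * algebraMap (𝓞 F) F γ / d ≠ 0 := by
      obtain ⟨φ, -⟩ := exists_ringHom_apply_eq hD hsd hadj (Real.sq_sqrt hDR.le)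
      intro h
      simpa [h] using hpos φ
    have heq : FractionalIdeal.spanSingleton (𝓞 F)⁰ (8 * (6 * algebraMap (𝓞 F) F γ / d))
              * FractionalIdeal.spanSingleton (𝓞 F)⁰ d
              * (P : FractionalIdeal (𝓞 F)⁰ F) * (P' : FractionalIdeal (𝓞 F)⁰ F)
            = (FractionalIdeal.spanSingleton (𝓞 F)⁰ 12
              * ((Ideal.span {γ, (c : 𝓞 F)} : Ideal (𝓞 F)) : FractionalIdeal (𝓞 F)⁰ F)) ^ 2 := by
      rw [mul_assoc, ← FractionalIdeal.coeIdeal_mul, hmul, mul_pow,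
        ← FractionalIdeal.coeIdeal_pow, hsqI, FractionalIdeal.coeIdeal_span_singleton,
        FractionalIdeal.coeIdeal_span_singleton, FractionalIdeal.spanSingleton_pow,
        FractionalIdeal.spanSingleton_mul_spanSingleton,
        FractionalIdeal.spanSingleton_mul_spanSingleton,
        FractionalIdeal.spanSingleton_mul_spanSingleton]
      congr 1
      rw [map_ofNat]
      field_simp
      ring
    refine ⟨_, hβ0, hpos, P, P', hPP, hPp, hP, hPp', hP', _, ?_, heq⟩
    refine mul_ne_zero (FractionalIdeal.spanSingleton_ne_zero_iff.mpr (by norm_num)) ?_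
    rw [FractionalIdeal.coeIdeal_ne_zero, ne_eq, Ideal.span_eq_bot]
    push Not
    exact ⟨(c : 𝓞 F), by simp, by exact_mod_cast hc0⟩
end

section
/- For every z in the upper half-plane ℍ, the Dedekind eta function η(z) = e^{2πiz/24}·∏_{m≥1}(1 − e^{2πimz}) satisfies η(z) = (1/2)·∑_{m ∈ ℤ} χ₁₂(m)·e^{2πi m² z/24}, where χ₁₂ is the primitive Dirichlet character modulo 12 (χ₁₂(m) = 1 for m ≡ ±1 (mod 12), χ₁₂(m) = −1 for m ≡ ±5 (mod 12), χ₁₂(m) = 0 if gcd(m, 12) > 1); equivalently η(z) = ∑_{m≥1} χ₁₂(m)·e^{2πi m² z/24}. -/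
open scoped UpperHalfPlane Real

open Complex

/-- The Dedekind eta function
`η(z) = e^{2πiz/24} · ∏_{m ≥ 1} (1 − e^{2πimz})`. -/
noncomputable def dedekindEta (z : ℂ) : ℂ :=
  Complex.exp (2 * π * I * z / 24) *
    ∏' m : ℕ, (1 - Complex.exp (2 * π * I * ((m : ℂ) + 1) * z))

/-- The primitive Dirichlet character mod 12: `χ₁₂(m) = 1` if `m ≡ ±1 (mod 12)`,
`χ₁₂(m) = −1` if `m ≡ ±5 (mod 12)`, and `χ₁₂(m) = 0` otherwise. -/
def chiTwelve (m : ℤ) : ℤ :=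
  if m % 12 = 1 ∨ m % 12 = 11 then 1
  else if m % 12 = 5 ∨ m % 12 = 7 then -1
  else 0

theorem norm_prod_one_sub_pow_le {q : ℂ} (hq : ‖q‖ < 1) (k n : ℕ) :
    ‖∏ i ∈ Finset.range n, (1 - q ^ (k + i + 1))‖ ≤ Real.exp (1 - ‖q‖)⁻¹ := by
  calc ‖∏ i ∈ Finset.range n, (1 - q ^ (k + i + 1))‖
      ≤ ∏ i ∈ Finset.range n, Real.exp (‖q‖ ^ i) := by
        rw [norm_prod]
        refine Finset.prod_le_prod (fun _ _ ↦ norm_nonneg _) fun i _ ↦ ?_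
        calc ‖1 - q ^ (k + i + 1)‖ ≤ ‖(1 : ℂ)‖ + ‖q ^ (k + i + 1)‖ := norm_sub_le _ _
          _ = ‖q‖ ^ (k + i + 1) + 1 := by rw [norm_one, norm_pow, add_comm]
          _ ≤ ‖q‖ ^ i + 1 := by
            gcongr ?_ + 1
            exact pow_le_pow_of_le_one (norm_nonneg _) hq.le (by omega)
          _ ≤ Real.exp (‖q‖ ^ i) := Real.add_one_le_exp _
    _ ≤ Real.exp (1 - ‖q‖)⁻¹ := by
        rw [← Real.exp_sum, ← tsum_geometric_of_lt_one (norm_nonneg q) hq]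
        gcongr
        exact (summable_geometric_of_lt_one (norm_nonneg q) hq).sum_le_tsum _
          fun _ _ ↦ by positivity

theorem norm_pow_mul_prod_one_sub_pow_le {q : ℂ} (hq : ‖q‖ < 1) (k n : ℕ) :
    ‖q ^ ((k + 1) * n) * ∏ i ∈ Finset.range (n + 1), (1 - q ^ (k + i + 1))‖ ≤
      ‖q‖ ^ n * Real.exp (1 - ‖q‖)⁻¹ := by
  rw [norm_mul, norm_pow]
  refine mul_le_mul ?_ (norm_prod_one_sub_pow_le hq k _) (norm_nonneg _) (by positivity)
  exact pow_le_pow_of_le_one (norm_nonneg _) hq.le (Nat.le_mul_of_pos_left _ k.succ_pos)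

theorem summable_negOnePow_mul_pow_pentagonal {q : ℂ} (hq : ‖q‖ < 1) :
    Summable fun k : ℤ ↦ ((k.negOnePow : ℤ) : ℂ) * q ^ pentagonal k := by
  refine .of_norm_bounded (g := fun k ↦ ‖q‖ ^ pentagonal k)
    ((summable_geometric_of_lt_one (norm_nonneg q) hq).comp_injective pentagonal_injective)
    fun k ↦ ?_
  rcases Int.even_or_odd k with h | h <;>
    simp [Int.negOnePow_even, Int.negOnePow_odd, h]

/-- **Pentagonal number theorem** for complex numbers in the open unit disc. -/
theorem hasSum_negOnePow_mul_pow_pentagonal {q : ℂ} (hq : ‖q‖ < 1) :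
    HasSum (fun k : ℤ ↦ ((k.negOnePow : ℤ) : ℂ) * q ^ pentagonal k)
      (∏' n : ℕ, (1 - q ^ (n + 1))) := by
  have hsum : Summable fun n : ℕ ↦ ‖q‖ ^ n * Real.exp (1 - ‖q‖)⁻¹ :=
    (summable_geometric_of_lt_one (norm_nonneg q) hq).mul_right _
  have hpair : HasSum (fun k : ℕ ↦ (-1) ^ k * (q ^ pentagonal (-k) - q ^ pentagonal (k + 1)))
      (∑' k : ℤ, ((k.negOnePow : ℤ) : ℂ) * q ^ pentagonal k) := by
    have h := (summable_negOnePow_mul_pow_pentagonal hq).hasSum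
    rw [← (Equiv.neg ℤ).hasSum_iff] at h
    convert h.nat_add_neg_add_one using 2 with k
    simp only [Function.comp_apply, Equiv.neg_apply, neg_neg, Int.negOnePow_neg,
      Int.negOnePow_succ, Units.val_neg, Int.cast_neg, Int.coe_negOnePow_natCast]
    push_cast
    ring
  have htail : Filter.Tendsto (fun k : ℕ ↦ (-1) ^ (k + 1) * q ^ ((k + 1) * (3 * k + 4) / 2) *
      ∑' n : ℕ, q ^ ((k + 1) * n) * ∏ i ∈ Finset.range (n + 1), (1 - q ^ (k + i + 1)))
      Filter.atTop (nhds 0) := by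
    refine squeeze_zero_norm
      (a := fun k ↦ ‖q‖ ^ k * ∑' n : ℕ, ‖q‖ ^ n * Real.exp (1 - ‖q‖)⁻¹) (fun k ↦ ?_) ?_
    · rw [norm_mul]
      refine mul_le_mul ?_ (tsum_of_norm_bounded hsum.hasSum
        (norm_pow_mul_prod_one_sub_pow_le hq k)) (norm_nonneg _) (by positivity)
      simp only [norm_mul, norm_pow, norm_neg, norm_one, one_pow, one_mul]
      refine pow_le_pow_of_le_one (norm_nonneg _) hq.le ?_
      rw [Nat.le_div_iff_mul_le two_pos]
      nlinarith
    · simpa using (tendsto_pow_atTop_nhds_zero_of_lt_one (norm_nonneg q) hq).mul_const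
        (∑' n : ℕ, ‖q‖ ^ n * Real.exp (1 - ‖q‖)⁻¹)
  rw [Pentagonal.tprod_one_sub_pow (tendsto_pow_atTop_nhds_zero_of_norm_lt_one hq)
    (fun k ↦ .of_norm_bounded hsum (norm_pow_mul_prod_one_sub_pow_le hq k)) (fun k ↦ ?_)
    hpair.summable htail, hpair.tsum_eq]
  · exact (summable_negOnePow_mul_pow_pentagonal hq).hasSum
  · simpa [sub_eq_add_neg] using multipliable_one_add_of_summable (R := ℂ)
      (f := fun n ↦ -q ^ (n + k + 1)) (by
        simpa [add_assoc] using
          (summable_nat_add_iff (k + 1)).2 (summable_geometric_of_lt_one (norm_nonneg q) hq))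

theorem chiTwelve_six_mul_sub_one (k : ℤ) : chiTwelve (6 * k - 1) = k.negOnePow := by
  rcases Int.even_or_odd' k with ⟨j, rfl | rfl⟩
  · rw [Int.negOnePow_even _ (even_two_mul j), chiTwelve, if_pos (by omega), Units.val_one]
  · rw [Int.negOnePow_odd _ (odd_two_mul_add_one j), chiTwelve, if_neg (by omega),
      if_pos (by omega), Units.val_neg, Units.val_one]

theorem chiTwelve_neg (m : ℤ) : chiTwelve (-m) = chiTwelve m := by
  unfold chiTwelve
  split_ifs <;> omega

/-- The Dedekind eta function as a theta series over the positive integers. -/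
theorem hasSum_dedekindEta (z : ℍ) :
    HasSum (fun m : ℕ ↦ (chiTwelve ((m : ℤ) + 1) : ℂ) *
      Complex.exp (2 * π * I * ((m : ℂ) + 1) ^ 2 * (z : ℂ) / 24)) (dedekindEta z) := by
  have hq : ‖Complex.exp (2 * π * I * z)‖ < 1 := UpperHalfPlane.norm_exp_two_pi_I_lt_one z
  have hinj : Function.Injective fun k : ℤ ↦ (6 * k - 1).natAbs - 1 := fun a b h ↦ by
    dsimp only at h
    omega
  have heta : dedekindEta z = Complex.exp (2 * π * I * z / 24) *
      ∏' n : ℕ, (1 - Complex.exp (2 * π * I * z) ^ (n + 1)) := by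
    rw [dedekindEta]
    congr! 4 with m
    rw [← Complex.exp_nat_mul]
    congr 1
    push_cast
    ring
  rw [heta, ← hinj.hasSum_iff]
  · have h := (hasSum_negOnePow_mul_pow_pentagonal hq).mul_left
      (Complex.exp (2 * π * I * z / 24))
    refine h.congr_fun fun k ↦ ?_
    have hcast : (((6 * k - 1).natAbs - 1 : ℕ) : ℤ) + 1 = |6 * k - 1| := by
      rw [Int.abs_eq_natAbs]
      omega
    have hcastC : (((6 * k - 1).natAbs - 1 : ℕ) : ℂ) + 1 = ((|6 * k - 1| : ℤ) : ℂ) := by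
      exact_mod_cast congrArg (Int.cast : ℤ → ℂ) hcast
    have hchi : chiTwelve |6 * k - 1| = k.negOnePow := by
      rw [← chiTwelve_six_mul_sub_one]
      rcases abs_choice (6 * k - 1) with h | h <;> rw [h]
      exact chiTwelve_neg _
    have hpent : 2 * (pentagonal k : ℂ) = k * (3 * k - 1) := by
      exact_mod_cast two_mul_natCast_pentagonal k
    simp only [Function.comp_apply]
    rw [hcast, hcastC, hchi, ← Int.cast_pow, sq_abs, mul_left_comm, ← Complex.exp_nat_mul,
      ← Complex.exp_add]
    congr 2
    push_cast
    linear_combination -(π * I * z : ℂ) * hpent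
  · intro m hm
    have hchi : chiTwelve ((m : ℤ) + 1) = 0 := by
      have h₁ : (6 * (((m : ℤ) + 2) / 6) - 1).natAbs - 1 ≠ m := fun h ↦ hm ⟨_, h⟩
      have h₂ : (6 * (-((m : ℤ) / 6)) - 1).natAbs - 1 ≠ m := fun h ↦ hm ⟨_, h⟩
      unfold chiTwelve
      split_ifs <;> omega
    simp [hchi]

/-- For every `z` in the upper half-plane,
`η(z) = (1/2) · ∑_{m ∈ ℤ} χ₁₂(m) · e^{2πi m² z/24}`; equivalently
`η(z) = ∑_{m ≥ 1} χ₁₂(m) · e^{2πi m² z/24}`. -/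
theorem stmt15 (z : ℍ) :
    dedekindEta (z : ℂ) = (1 / 2) *
      ∑' m : ℤ, (chiTwelve m : ℂ) *
        Complex.exp (2 * π * I * (m : ℂ) ^ 2 * (z : ℂ) / 24) ∧
    dedekindEta (z : ℂ) =
      ∑' m : ℕ, (chiTwelve ((m : ℤ) + 1) : ℂ) *
        Complex.exp (2 * π * I * ((m : ℂ) + 1) ^ 2 * (z : ℂ) / 24) := by
  have h := hasSum_dedekindEta z
  refine ⟨?_, h.tsum_eq.symm⟩
  have hint : HasSum (fun m : ℤ ↦ (chiTwelve m : ℂ) *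
      Complex.exp (2 * π * I * (m : ℂ) ^ 2 * (z : ℂ) / 24))
      (dedekindEta z + 0 + dedekindEta z) := by
    convert HasSum.of_add_one_of_neg_add_one (f := fun m : ℤ ↦ (chiTwelve m : ℂ) *
      Complex.exp (2 * π * I * (m : ℂ) ^ 2 * (z : ℂ) / 24)) (m := dedekindEta z)
      (m' := dedekindEta z) ?_ ?_ using 2
    · simp [chiTwelve]
    · simpa using h
    · simp only [chiTwelve_neg, Int.cast_neg, neg_sq]
      simpa using h
  rw [hint.tsum_eq]
  ring
end

section
/- For every z in the upper half-plane ℍ, the cube of the Dedekind eta function satisfies η(z)³ = (1/2)·∑_{m ∈ ℤ} m·χ₄(m)·e^{2πi m² z/8}, where χ₄ is the primitive Dirichlet character modulo 4 (χ₄(m) = 1 for m ≡ 1 (mod 4), χ₄(m) = −1 for m ≡ 3 (mod 4), χ₄(m) = 0 for even m); equivalently η(z)³ = ∑_{m≥1} m·χ₄(m)·e^{2πi m² z/8}. -/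
open scoped UpperHalfPlane Real

open Complex

/-- The primitive Dirichlet character mod 4: `χ₄(m) = 1` if `m ≡ 1 (mod 4)`,
`χ₄(m) = −1` if `m ≡ 3 (mod 4)`, and `χ₄(m) = 0` for even `m`. -/
def chiFour (m : ℤ) : ℤ :=
  if m % 4 = 1 then 1
  else if m % 4 = 3 then -1
  else 0

open Filter Topology

/-- The reciprocal `1 / ((1 - q) ⋯ (1 - q ^ n))` of the `q`-Pochhammer symbol, extended by zero to
negative `n`. -/
noncomputable def invQPochhammer (q : ℂ) (n : ℤ) : ℂ :=
  if 0 ≤ n then (∏ i ∈ Finset.range n.toNat, (1 - q ^ (i + 1)))⁻¹ else 0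

lemma invQPochhammer_natCast (q : ℂ) (n : ℕ) :
    invQPochhammer q n = (∏ i ∈ Finset.range n, (1 - q ^ (i + 1)))⁻¹ := by
  simp [invQPochhammer]

lemma invQPochhammer_of_neg (q : ℂ) {n : ℤ} (hn : n < 0) : invQPochhammer q n = 0 := by
  simp [invQPochhammer, hn]

lemma invQPochhammer_sub_one {q : ℂ} (hq : ∀ i : ℕ, 1 - q ^ (i + 1) ≠ 0) (n : ℤ) :
    invQPochhammer q (n - 1) = (1 - q ^ n) * invQPochhammer q n := by
  rcases lt_trichotomy n 0 with h | rfl | h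
  · simp [invQPochhammer_of_neg, h, show n - 1 < 0 by lia]
  · simp [invQPochhammer]
  · obtain ⟨m, rfl⟩ : ∃ m : ℕ, n = m + 1 := ⟨(n - 1).toNat, by lia⟩
    have h1 : ((m : ℤ) + 1) = ((m + 1 : ℕ) : ℤ) := by push_cast; ring
    rw [add_sub_cancel_right, h1, invQPochhammer_natCast, invQPochhammer_natCast,
      Finset.prod_range_succ, mul_inv_rev, zpow_natCast, mul_inv_cancel_left₀ (hq m)]

/-- The summand `(-1)ᵏ q ^ (k (k + 1) / 2) / ((q; q)_{N - k} (q; q)_{N + 1 + k})`, with the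
numerator given by `W k`. -/
noncomputable def finiteThetaTerm (q : ℂ) (W : ℤ → ℂ) (N : ℕ) (k : ℤ) : ℂ :=
  W k * (invQPochhammer q (N - k) * invQPochhammer q (N + 1 + k))

lemma finiteThetaTerm_succ {q : ℂ} (hq0 : q ≠ 0) (hq : ∀ i : ℕ, 1 - q ^ (i + 1) ≠ 0)
    {W : ℤ → ℂ} (hW : ∀ k, W (k + 1) = -q ^ (k + 1) * W k) (N : ℕ) (k : ℤ) :
    (1 - q ^ (2 * N + 2)) * (1 - q ^ (2 * N + 3)) * finiteThetaTerm q W (N + 1) k =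
      (1 + q ^ (2 * N + 2)) * finiteThetaTerm q W N k -
        q ^ (N + 1) * (finiteThetaTerm q W N (k - 1) + finiteThetaTerm q W N (k + 1)) := by
  have hW' : q ^ k * W (k - 1) = -W k := by
    have := hW (k - 1)
    rw [sub_add_cancel] at this
    rw [this]; ring
  have hqk : q ^ k ≠ 0 := zpow_ne_zero _ hq0
  have hWk : W (k - 1) = -W k / q ^ k := by rw [eq_div_iff hqk, ← hW', mul_comm]
  have a1 := invQPochhammer_sub_one hq (N + 1 - k)
  have a2 := invQPochhammer_sub_one hq (N - k)
  have b1 := invQPochhammer_sub_one hq (N + 2 + k)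
  have b2 := invQPochhammer_sub_one hq (N + 1 + k)
  rw [show (N + 1 - k - 1 : ℤ) = N - k by ring] at a1
  rw [show (N + 2 + k - 1 : ℤ) = N + 1 + k by ring] at b1
  rw [a1] at a2
  rw [b1] at b2
  simp only [finiteThetaTerm]
  push_cast
  rw [hW, hWk, show (N - (k - 1) : ℤ) = N + 1 - k by ring,
    show (N + 1 + (k - 1) : ℤ) = N + 1 + k - 1 by ring, show (N - (k + 1) : ℤ) = N - k - 1 by ring,
    show (N + 1 + (k + 1) : ℤ) = N + 2 + k by ring,
    show (N + 1 + 1 + k : ℤ) = N + 2 + k by ring, a2, b2, a1, b1]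
  have e1 : q ^ (N + 1 - k : ℤ) = q ^ N * q / q ^ k := by
    rw [zpow_sub₀ hq0, zpow_add₀ hq0]; simp
  have e2 : q ^ (N - k : ℤ) = q ^ N / q ^ k := by rw [zpow_sub₀ hq0]; simp
  have e3 : q ^ (N + 2 + k : ℤ) = q ^ N * q ^ 2 * q ^ k := by
    rw [zpow_add₀ hq0, zpow_add₀ hq0]; norm_cast
  have e4 : q ^ (N + 1 + k : ℤ) = q ^ N * q * q ^ k := by
    rw [zpow_add₀ hq0, zpow_add₀ hq0]; simp
  have e5 : q ^ (k + 1) = q ^ k * q := zpow_add_one₀ hq0 k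
  rw [e1, e2, e3, e4, e5, show q ^ (2 * N + 2) = (q ^ N) ^ 2 * q ^ 2 by ring,
    show q ^ (2 * N + 3) = (q ^ N) ^ 2 * q ^ 3 by ring, pow_succ q N]
  generalize q ^ k = x at *
  generalize q ^ N = y at *
  generalize invQPochhammer q _ = A
  generalize invQPochhammer q _ = B
  field_simp
  ring

lemma finiteThetaTerm_eq_zero (q : ℂ) (W : ℤ → ℂ) {N : ℕ} {k : ℤ}
    (hk : k ∉ Finset.Icc (-(N : ℤ) - 1) N) : finiteThetaTerm q W N k = 0 := by
  rw [Finset.mem_Icc, not_and_or] at hk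
  rcases hk with h | h
  · simp [finiteThetaTerm, invQPochhammer_of_neg q (show (N + 1 + k : ℤ) < 0 by lia)]
  · simp [finiteThetaTerm, invQPochhammer_of_neg q (show (N - k : ℤ) < 0 by lia)]

lemma summable_mul_finiteThetaTerm (q : ℂ) (W c : ℤ → ℂ) (N : ℕ) :
    Summable fun k ↦ c k * finiteThetaTerm q W N k :=
  summable_of_ne_finset_zero (s := Finset.Icc (-(N : ℤ) - 1) N) fun k hk ↦ by
    rw [finiteThetaTerm_eq_zero q W hk, mul_zero]

/-- A finite form of Jacobi's identity for the cube of the Euler product. -/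
lemma tsum_finiteThetaTerm {q : ℂ} (hq0 : q ≠ 0) (hq : ∀ i : ℕ, 1 - q ^ (i + 1) ≠ 0)
    {W : ℤ → ℂ} (hW : ∀ k, W (k + 1) = -q ^ (k + 1) * W k) (N : ℕ) :
    (∏ i ∈ Finset.range (2 * N + 1), (1 - q ^ (i + 1))) *
        ∑' k : ℤ, (2 * k + 1) * finiteThetaTerm q W N k =
      2 * W 0 * (∏ i ∈ Finset.range N, (1 - q ^ (i + 1))) ^ 2 := by
  induction N with
  | zero =>
    rw [tsum_eq_sum (s := Finset.Icc (-1) 0)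
      fun k hk ↦ by rw [finiteThetaTerm_eq_zero q W (by simpa using hk), mul_zero]]
    have hW0 : W (-1) = -W 0 := by
      have := hW (-1)
      norm_num at this
      rw [this, neg_neg]
    have h0 : invQPochhammer q 0 = 1 := by simp [invQPochhammer]
    have h1 : invQPochhammer q 1 = (1 - q)⁻¹ := by simp [invQPochhammer]
    have := hq 0
    rw [show Finset.Icc (-1 : ℤ) 0 = {-1, 0} by rfl]
    simp [finiteThetaTerm, hW0, h0, h1] at this ⊢
    field_simp
    ring
  | succ N ih =>
    have key : (1 - q ^ (2 * N + 2)) * (1 - q ^ (2 * N + 3)) *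
        ∑' k : ℤ, (2 * k + 1) * finiteThetaTerm q W (N + 1) k =
        (1 - q ^ (N + 1)) ^ 2 * ∑' k : ℤ, (2 * k + 1) * finiteThetaTerm q W N k := by
      have hl : ∑' k : ℤ, (2 * k + 1 : ℂ) * finiteThetaTerm q W N (k - 1) =
          ∑' k : ℤ, (2 * k + 3 : ℂ) * finiteThetaTerm q W N k := by
        rw [← (Equiv.addRight (1 : ℤ)).tsum_eq]
        refine tsum_congr fun k ↦ ?_
        simp only [Equiv.coe_addRight, add_sub_cancel_right]
        push_cast; ring
      have hr : ∑' k : ℤ, (2 * k + 1 : ℂ) * finiteThetaTerm q W N (k + 1) =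
          ∑' k : ℤ, (2 * k - 1 : ℂ) * finiteThetaTerm q W N k := by
        rw [← (Equiv.subRight (1 : ℤ)).tsum_eq]
        refine tsum_congr fun k ↦ ?_
        simp only [Equiv.subRight_apply, sub_add_cancel]
        push_cast; ring
      have sl : Summable fun k : ℤ ↦ (2 * k + 1 : ℂ) * finiteThetaTerm q W N (k - 1) := by
        rw [← (Equiv.addRight (1 : ℤ)).summable_iff]
        simpa [Function.comp_def] using
          summable_mul_finiteThetaTerm q W (fun k ↦ 2 * (k + 1) + 1) N
      have sr : Summable fun k : ℤ ↦ (2 * k + 1 : ℂ) * finiteThetaTerm q W N (k + 1) := by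
        rw [← (Equiv.subRight (1 : ℤ)).summable_iff]
        simpa [Function.comp_def] using
          summable_mul_finiteThetaTerm q W (fun k ↦ 2 * (k - 1) + 1) N
      have sm := summable_mul_finiteThetaTerm q W (fun k ↦ 2 * k + 1) N
      have hlr : ∑' k : ℤ, (2 * k + 3 : ℂ) * finiteThetaTerm q W N k +
          ∑' k : ℤ, (2 * k - 1 : ℂ) * finiteThetaTerm q W N k =
          2 * ∑' k : ℤ, (2 * k + 1 : ℂ) * finiteThetaTerm q W N k := by
        rw [← Summable.tsum_add (summable_mul_finiteThetaTerm q W (fun k ↦ 2 * k + 3) N)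
          (summable_mul_finiteThetaTerm q W (fun k ↦ 2 * k - 1) N), ← tsum_mul_left]
        exact tsum_congr fun k ↦ by ring
      rw [← tsum_mul_left]
      calc _ = ∑' k : ℤ, ((1 + q ^ (2 * N + 2)) * ((2 * k + 1) * finiteThetaTerm q W N k) -
            q ^ (N + 1) * ((2 * k + 1) * finiteThetaTerm q W N (k - 1) +
              (2 * k + 1) * finiteThetaTerm q W N (k + 1))) :=
            tsum_congr fun k ↦ by
              linear_combination (2 * k + 1 : ℂ) * finiteThetaTerm_succ hq0 hq hW N k
        _ = _ := by
          rw [(sm.mul_left _).tsum_sub ((sl.add sr).mul_left _), tsum_mul_left, tsum_mul_left,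
            sl.tsum_add sr, hl, hr, hlr]
          ring
    rw [show 2 * (N + 1) + 1 = 2 * N + 1 + 1 + 1 by ring, Finset.prod_range_succ,
      Finset.prod_range_succ, Finset.prod_range_succ _ N, mul_pow]
    linear_combination (∏ i ∈ Finset.range (2 * N + 1), (1 - q ^ (i + 1))) * key +
      (1 - q ^ (N + 1)) ^ 2 * ih

lemma one_sub_pow_ne_zero_of_norm_lt_one {q : ℂ} (hq : ‖q‖ < 1) (i : ℕ) :
    1 - q ^ (i + 1) ≠ 0 := by
  intro h
  have : ‖q ^ (i + 1)‖ < 1 := by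
    rw [norm_pow]; exact pow_lt_one₀ (norm_nonneg _) hq i.succ_ne_zero
  rw [← sub_eq_zero.mp h, norm_one] at this
  exact lt_irrefl _ this

lemma tprod_one_sub_pow_ne_zero {q : ℂ} (hq : ‖q‖ < 1) : ∏' n : ℕ, (1 - q ^ (n + 1)) ≠ 0 := by
  simp_rw [sub_eq_add_neg]
  refine tprod_one_add_ne_zero_of_summable (f := fun n ↦ -q ^ (n + 1)) (fun i ↦ ?_) ?_
  · simpa [← sub_eq_add_neg] using one_sub_pow_ne_zero_of_norm_lt_one hq i
  · simpa using (summable_nat_add_iff 1).mpr (summable_geometric_of_lt_one (norm_nonneg _) hq)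

lemma tendsto_invQPochhammer {q : ℂ} (hq : ‖q‖ < 1) :
    Tendsto (invQPochhammer q) atTop (𝓝 (∏' n : ℕ, (1 - q ^ (n + 1)))⁻¹) := by
  have h := ((ModularForm.multipliable_one_sub_pow hq).tendsto_prod_tprod_nat.inv₀
    (tprod_one_sub_pow_ne_zero hq)).comp
      (tendsto_atTop_atTop.mpr fun b ↦ ⟨b, fun a ha ↦ by lia⟩ : Tendsto Int.toNat atTop atTop)
  refine h.congr' ?_
  filter_upwards [eventually_ge_atTop 0] with n hn
  simp [invQPochhammer, hn]

lemma exists_norm_invQPochhammer_le {q : ℂ} (hq : ‖q‖ < 1) :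
    ∃ C, ∀ n, ‖invQPochhammer q n‖ ≤ C := by
  have h := (tendsto_invQPochhammer hq).comp tendsto_natCast_atTop_atTop
  obtain ⟨C, hC⟩ := h.norm.bddAbove_range
  refine ⟨C, fun n ↦ ?_⟩
  have hC' (m : ℕ) : ‖invQPochhammer q m‖ ≤ C := hC ⟨m, rfl⟩
  rcases lt_or_ge n 0 with hn | hn
  · simpa [invQPochhammer_of_neg q hn] using (norm_nonneg _).trans (hC' 0)
  · lift n to ℕ using hn
    exact hC' n

/-- Jacobi's identity for the cube of the Euler product, with the theta series summed over `ℤ`. -/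
lemma tsum_eq_two_mul_tprod_pow_three {q : ℂ} (hq0 : q ≠ 0) (hq : ‖q‖ < 1)
    {W : ℤ → ℂ} (hW : ∀ k, W (k + 1) = -q ^ (k + 1) * W k)
    (hs : Summable fun k : ℤ ↦ (2 * k + 1) * W k) :
    ∑' k : ℤ, (2 * k + 1) * W k = 2 * W 0 * (∏' n : ℕ, (1 - q ^ (n + 1))) ^ 3 := by
  have hP := tprod_one_sub_pow_ne_zero hq
  have hPt := (ModularForm.multipliable_one_sub_pow hq).tendsto_prod_tprod_nat
  set P := ∏' n : ℕ, (1 - q ^ (n + 1))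
  obtain ⟨C, hC⟩ := exists_norm_invQPochhammer_le hq
  have hC0 : 0 ≤ C := (norm_nonneg _).trans (hC 0)
  have hlim : Tendsto (fun N : ℕ ↦ ∑' k : ℤ, (2 * k + 1) * finiteThetaTerm q W N k) atTop
      (𝓝 (∑' k : ℤ, (2 * k + 1) * (W k * (P⁻¹ * P⁻¹)))) := by
    refine tendsto_tsum_of_dominated_convergence
      (bound := fun k : ℤ ↦ ‖(2 * k + 1) * W k‖ * (C * C)) (hs.norm.mul_right _) (fun k ↦ ?_)
      (Eventually.of_forall fun N k ↦ ?_)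
    · have t (f : ℕ → ℤ) (hf : ∀ b : ℤ, ∃ i : ℕ, ∀ a : ℕ, i ≤ a → b ≤ f a) :
          Tendsto (fun N ↦ invQPochhammer q (f N)) atTop (𝓝 P⁻¹) :=
        (tendsto_invQPochhammer hq).comp (tendsto_atTop_atTop.mpr hf)
      exact (((t _ fun b ↦ ⟨(b + k).toNat, fun a ha ↦ by lia⟩).mul
        (t _ fun b ↦ ⟨(b - k).toNat, fun a ha ↦ by lia⟩)).const_mul _).const_mul _
    · rw [finiteThetaTerm, ← mul_assoc, norm_mul, norm_mul (invQPochhammer q _)]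
      gcongr <;> apply hC
  have h2 : Tendsto (fun N : ℕ ↦ 2 * N + 1) atTop atTop :=
    tendsto_atTop_atTop.mpr fun b ↦ ⟨b, fun a ha ↦ by lia⟩
  have heq := tendsto_nhds_unique
    (((hPt.comp h2).mul hlim).congr fun N ↦
      tsum_finiteThetaTerm hq0 (one_sub_pow_ne_zero_of_norm_lt_one hq) hW N)
    ((hPt.pow 2).const_mul (2 * W 0))
  simp_rw [← mul_assoc, tsum_mul_right] at heq
  field_simp at heq
  linear_combination heq

lemma chiFour_two_mul_add_one (k : ℤ) : (chiFour (2 * k + 1) : ℂ) = (-1) ^ k := by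
  rcases Int.even_or_odd' k with ⟨m, rfl | rfl⟩
  · simp [chiFour, show (2 * (2 * m) + 1) % 4 = 1 by lia, zpow_mul]
  · simp [chiFour, show (2 * (2 * m + 1) + 1) % 4 = 3 by lia, zpow_mul, zpow_add₀]

lemma chiFour_two_mul (k : ℤ) : chiFour (2 * k) = 0 := by
  simp [chiFour, show (2 * k) % 4 ≠ 1 by lia, show (2 * k) % 4 ≠ 3 by lia]

lemma chiFour_neg (k : ℤ) : chiFour (-k) = -chiFour k := by
  unfold chiFour; split_ifs <;> lia

/-- The summand `m χ₄(m) e^{2πi m² z/8}` of the theta series for `η³`. -/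
noncomputable def etaCubeTerm (z : ℂ) (m : ℤ) : ℂ :=
  (m : ℂ) * (chiFour m : ℂ) * Complex.exp (2 * π * I * (m : ℂ) ^ 2 * z / 8)

lemma etaCubeTerm_neg (z : ℂ) (m : ℤ) : etaCubeTerm z (-m) = etaCubeTerm z m := by
  simp [etaCubeTerm, chiFour_neg]

lemma etaCubeTerm_support_subset (z : ℂ) :
    Function.support (etaCubeTerm z) ⊆ Set.range fun k : ℤ ↦ 2 * k + 1 := by
  intro m hm
  rcases Int.even_or_odd' m with ⟨k, rfl | rfl⟩
  · simp [etaCubeTerm, chiFour_two_mul] at hm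
  · exact ⟨k, rfl⟩

lemma two_mul_add_one_injective : Function.Injective fun k : ℤ ↦ 2 * k + 1 :=
  fun a b h ↦ by simpa using h

lemma etaCubeTerm_two_mul_add_one (z : ℂ) (k : ℤ) :
    etaCubeTerm z (2 * k + 1) =
      (2 * k + 1) * (cexp (2 * π * I * z / 8) * jacobiTheta₂_term k ((z + 1) / 2) z) := by
  rw [etaCubeTerm, chiFour_two_mul_add_one, jacobiTheta₂_term, ← Complex.exp_pi_mul_I,
    ← Complex.exp_int_mul, mul_assoc, ← Complex.exp_add, ← Complex.exp_add]
  push_cast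
  congr 2
  ring

lemma summable_two_mul_add_one_mul_jacobiTheta₂_term (w : ℂ) {τ : ℂ} (hτ : 0 < τ.im) :
    Summable fun k : ℤ ↦ (2 * k + 1) * jacobiTheta₂_term k w τ := by
  convert! (((hasSum_jacobiTheta₂'_term w hτ).summable.mul_left (π * I)⁻¹).add
    (hasSum_jacobiTheta₂_term w hτ).summable) using 2 with k
  rw [jacobiTheta₂'_term]
  field_simp [Complex.I_ne_zero]

lemma summable_etaCubeTerm {z : ℂ} (hz : 0 < z.im) : Summable (etaCubeTerm z) := by
  rw [← two_mul_add_one_injective.summable_iff fun m hm ↦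
    Function.notMem_support.mp fun h ↦ hm (etaCubeTerm_support_subset z h)]
  simp_rw [Function.comp_def, etaCubeTerm_two_mul_add_one, mul_left_comm _ (cexp _)]
  exact (summable_two_mul_add_one_mul_jacobiTheta₂_term _ hz).mul_left _

lemma tsum_etaCubeTerm (z : ℍ) : ∑' m, etaCubeTerm z m = 2 * dedekindEta z ^ 3 := by
  rw [← two_mul_add_one_injective.tsum_eq (etaCubeTerm_support_subset z)]
  simp_rw [etaCubeTerm_two_mul_add_one, mul_left_comm _ (cexp _), tsum_mul_left]
  have hW (k : ℤ) : jacobiTheta₂_term (k + 1) (((z : ℂ) + 1) / 2) z =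
      -cexp (2 * π * I * z) ^ (k + 1) * jacobiTheta₂_term k (((z : ℂ) + 1) / 2) z := by
    rw [jacobiTheta₂_term, jacobiTheta₂_term, ← Complex.exp_int_mul, ← neg_one_mul,
      ← Complex.exp_pi_mul_I, ← Complex.exp_add, ← Complex.exp_add]
    push_cast
    congr 1
    ring
  rw [tsum_eq_two_mul_tprod_pow_three (Complex.exp_ne_zero _)
    (UpperHalfPlane.norm_exp_two_pi_I_lt_one z) hW
    (summable_two_mul_add_one_mul_jacobiTheta₂_term _ z.im_pos), dedekindEta, mul_pow,
    ← Complex.exp_nat_mul]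
  have hprod (n : ℕ) : cexp (2 * π * I * ((n : ℂ) + 1) * z) = cexp (2 * π * I * z) ^ (n + 1) := by
    rw [← Complex.exp_nat_mul]; push_cast; ring_nf
  simp_rw [hprod, show ((3 : ℕ) : ℂ) * (2 * π * I * z / 24) = 2 * π * I * z / 8 by push_cast; ring]
  simp [jacobiTheta₂_term]
  ring

lemma tsum_etaCubeTerm_eq_two_mul {z : ℂ} (hz : 0 < z.im) :
    ∑' m, etaCubeTerm z m = 2 * ∑' m : ℕ, etaCubeTerm z (m + 1) := by
  have h : Summable fun m : ℕ ↦ etaCubeTerm z (m + 1) :=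
    (summable_etaCubeTerm hz).comp_injective (i := fun m : ℕ ↦ (m + 1 : ℤ))
      fun a b h ↦ by simpa using h
  rw [tsum_of_add_one_of_neg_add_one h (by simpa only [etaCubeTerm_neg] using h)]
  simp_rw [etaCubeTerm_neg]
  simp [etaCubeTerm]
  ring

/-- For every `z` in the upper half-plane,
`η(z)³ = (1/2) · ∑_{m ∈ ℤ} m · χ₄(m) · e^{2πi m² z/8}`; equivalently
`η(z)³ = ∑_{m ≥ 1} m · χ₄(m) · e^{2πi m² z/8}`. -/
theorem stmt16 (z : ℍ) :
    dedekindEta (z : ℂ) ^ 3 = (1 / 2) *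
      ∑' m : ℤ, (m : ℂ) * (chiFour m : ℂ) *
        Complex.exp (2 * π * I * (m : ℂ) ^ 2 * (z : ℂ) / 8) ∧
    dedekindEta (z : ℂ) ^ 3 =
      ∑' m : ℕ, ((m : ℂ) + 1) * (chiFour ((m : ℤ) + 1) : ℂ) *
        Complex.exp (2 * π * I * ((m : ℂ) + 1) ^ 2 * (z : ℂ) / 8) := by
  have h := tsum_etaCubeTerm z
  have h' := tsum_etaCubeTerm_eq_two_mul z.im_pos
  refine ⟨?_, ?_⟩
  · change _ = (1 / 2) * ∑' m, etaCubeTerm z m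
    rw [h]
    ring
  · have : ∑' m : ℕ, etaCubeTerm z (m + 1) = dedekindEta z ^ 3 := by
      linear_combination (h - h') / 2
    rw [← this]
    simp [etaCubeTerm]
end
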